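/- Let $p$ be a prime and $V$ an abelian group. The canonical map $\mathrm{colim}_{i \in \mathbb{N}} \mathrm{Pol}(V/p^iV, \mathbb{F}_p) \to \mathrm{Pol}(V, \mathbb{F}_p)$, induced by the projections $V \to V/p^iV$, is an isomorphism, where $\mathrm{Pol}$ denotes the group of polynomial functions (of some finite degree). -/

import Mathlib

/-- A function `f : V → W` between abelian groups is polynomial of degree at most `d` if its
`(d+1)`-st cross effect vanishes. -/
def IsPolynomialDeg {V W : Type*} [AddCommGroup V] [AddCommGroup W] (d : ℕ) (f : V → W) : Prop :=
  ∀ v : Fin (d + 1) → V,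
    ∑ S : Finset (Fin (d + 1)), (-1 : ℤ) ^ S.card • f (∑ i ∈ S, v i) = 0

/-- The subgroup `p^i V` of `V`, as a `ℤ`-submodule. -/
def pPowSub (V : Type*) [AddCommGroup V] (p i : ℕ) : Submodule ℤ V :=
  LinearMap.range (((p : ℤ) ^ i) • (LinearMap.id : V →ₗ[ℤ] V))

open AddMonoidAlgebra

/-- The `R`-linear extension of a function `f : V → R` to the group algebra of `V`. -/
noncomputable def groupAlgebraExtension {R V : Type*} [CommRing R] (f : V → R) :
    AddMonoidAlgebra R V →ₗ[R] R :=
  Finsupp.linearCombination R f ∘ₗ (coeffLinearEquiv R).toLinearMap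

@[simp]
lemma groupAlgebraExtension_single {R V : Type*} [CommRing R] (f : V → R) (a : V) (r : R) :
    groupAlgebraExtension f (single a r) = r * f a := by
  simp [groupAlgebraExtension]

lemma groupAlgebraExtension_prod_one_sub_single {R V ι : Type*} [CommRing R] [AddCommGroup V]
    [Fintype ι] (f : V → R) (v : ι → V) :
    groupAlgebraExtension f (∏ i, (1 - single (v i) 1)) =
      ∑ S : Finset ι, (-1 : ℤ) ^ S.card • f (∑ i ∈ S, v i) := by
  classical
  have h (S : Finset ι) : ∏ i ∈ S, (single (v i) 1 : AddMonoidAlgebra R V) =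
      single (∑ i ∈ S, v i) 1 := by
    induction S using Finset.induction_on with
    | empty => simp [one_def]
    | insert a S ha ih => simp [Finset.prod_insert ha, Finset.sum_insert ha, ih, single_mul_single]
  simp only [sub_eq_add_neg, Finset.prod_one_add, Finset.powerset_univ, Finset.prod_neg, h, map_sum]
  refine Finset.sum_congr rfl fun S _ => ?_
  rcases Nat.even_or_odd S.card with hc | hc <;> simp [hc.neg_one_pow]

lemma IsPolynomialDeg.groupAlgebraExtension_mul_pow {R V : Type*} [CommRing R] [AddCommGroup V]
    {d : ℕ} {f : V → R} (hf : IsPolynomialDeg d f) (x : AddMonoidAlgebra R V) (w : V) :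
    groupAlgebraExtension f (x * (1 - single w 1) ^ (d + 1)) = 0 := by
  have key (u : V) :
      groupAlgebraExtension f ((1 - single u 1) * (1 - single w 1) ^ d) = 0 := by
    have := (groupAlgebraExtension_prod_one_sub_single f (Fin.cons u fun _ : Fin d => w)).trans
      (hf _)
    simpa [Fin.prod_univ_succ] using this
  induction x using AddMonoidAlgebra.induction_linear with
  | zero => simp
  | add x y hx hy => rw [add_mul, map_add, hx, hy, add_zero]
  | single u r =>
    have h1 : (single u r * (1 - single w 1) ^ (d + 1) : AddMonoidAlgebra R V) =
        r • ((1 - single (u + w) 1) * (1 - single w 1) ^ d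
          - (1 - single u 1) * (1 - single w 1) ^ d) := by
      have h2 : (single u r : AddMonoidAlgebra R V) = r • single u 1 := by simp
      have h3 : (single (u + w) 1 : AddMonoidAlgebra R V) = single u 1 * single w 1 := by
        simp [single_mul_single]
      rw [h2, h3, smul_mul_assoc]
      congr 1
      ring
    rw [h1, map_smul, map_sub, key, key, sub_zero, smul_zero]

/-- A polynomial function of degree at most `d` into a ring of characteristic `p` is invariant
under translation by `p ^ i • V` as soon as `d < p ^ i`. -/
lemma IsPolynomialDeg.apply_add_pow_smul {R V : Type*} [CommRing R] [AddCommGroup V]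
    (p : ℕ) [Fact p.Prime] [CharP R p] {d i : ℕ} {f : V → R} (hf : IsPolynomialDeg d f)
    (hi : d < p ^ i) (u w : V) : f (u + p ^ i • w) = f u := by
  have : CharP (AddMonoidAlgebra R V) p :=
    charP_of_injective_algebraMap (FaithfulSMul.algebraMap_injective R _) p
  have h := hf.groupAlgebraExtension_mul_pow
    (single u 1 * (1 - single w 1) ^ (p ^ i - (d + 1))) w
  rw [mul_assoc, ← pow_add, Nat.sub_add_cancel hi, sub_pow_char_pow, one_pow, single_pow,
    mul_sub, mul_one, single_mul_single, map_sub] at h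
  simpa [sub_eq_zero, eq_comm] using h

lemma IsPolynomialDeg.of_comp_surjective {V V' W : Type*} [AddCommGroup V] [AddCommGroup V']
    [AddCommGroup W] {d : ℕ} {g : V' → W} (q : V →ₗ[ℤ] V') (hq : Function.Surjective q)
    (h : IsPolynomialDeg d fun v => g (q v)) : IsPolynomialDeg d g := by
  intro v
  choose s hs using hq
  simpa [map_sum, hs] using h fun i => s (v i)

/-- the canonical map `colim_i Pol(V/p^iV, 𝔽p) → Pol(V, 𝔽p)` is an isomorphism:
every polynomial function on `V` factors through some `V/p^iV` as a polynomial function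
(surjectivity), and polynomial functions on `V/p^iV` are determined by their pullback to `V`
(injectivity). -/
theorem stmt6 (p : ℕ) [Fact p.Prime] (V : Type*) [AddCommGroup V] :
    (∀ f : V → ZMod p, (∃ d, IsPolynomialDeg d f) →
      ∃ (i : ℕ) (g : (V ⧸ pPowSub V p i) → ZMod p), (∃ d, IsPolynomialDeg d g) ∧
        f = fun v => g ((pPowSub V p i).mkQ v)) ∧
    (∀ (i : ℕ) (g g' : (V ⧸ pPowSub V p i) → ZMod p), (∃ d, IsPolynomialDeg d g) →
      (∃ d, IsPolynomialDeg d g') →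
      (∀ v : V, g ((pPowSub V p i).mkQ v) = g' ((pPowSub V p i).mkQ v)) → g = g') := by
  constructor
  · rintro f ⟨d, hf⟩
    have hd : d < p ^ d := Nat.lt_pow_self (Fact.out : p.Prime).one_lt
    have hlift : ∀ a b : V, (pPowSub V p d).quotientRel a b → f a = f b := by
      intro a b hab
      rw [Submodule.quotientRel_def] at hab
      obtain ⟨w, hw⟩ := hab
      have ha : a = b + p ^ d • w := by
        rw [eq_comm, ← eq_sub_iff_add_eq', ← hw, ← natCast_zsmul,
          LinearMap.smul_apply, LinearMap.id_apply, Nat.cast_pow]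
      rw [ha, hf.apply_add_pow_smul p hd]
    refine ⟨d, Quotient.lift f hlift, ⟨d, ?_⟩, rfl⟩
    exact IsPolynomialDeg.of_comp_surjective (pPowSub V p d).mkQ (Submodule.mkQ_surjective _) hf
  · intro i g g' _ _ h
    exact (Submodule.mkQ_surjective _).injective_comp_right (funext h)
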